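/- Let E be a complete real inner product space (a real Hilbert space), let G be a group, and let σ : G → AffineIsometryEquiv(E) be an action of G on E by affine isometric bijections. Let Ω ⊆ E be a nonempty convex subset that is open or closed, with σ(g)(Ω) ⊆ Ω for every g ∈ G. If Ω contains a point x whose orbit {σ(g)x : g ∈ G} is bounded, then there exists z ∈ Ω with σ(g)z = z for all g ∈ G. -/

import Mathlib

/-- In a closed convex subset of a Hilbert space, a bounded family of points has a unique
circumcenter, that is, a point minimizing the radius of an enclosing ball. -/
theorem exists_unique_circumcenter_of_isClosed_convex
    {E : Type*} [NormedAddCommGroup E] [InnerProductSpace ℝ E] [CompleteSpace E]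
    {ι : Type*} [Nonempty ι] {u : ι → E} (hu : Bornology.IsBounded (Set.range u))
    {C : Set E} (hconv : Convex ℝ C) (hclosed : IsClosed C) (hne : C.Nonempty) :
    ∃ m : ℝ, ∃! z, z ∈ C ∧ ∀ i, ‖u i - z‖ ^ 2 ≤ m := by
  let S : Set ℝ := {c | ∃ y ∈ C, ∀ i, ‖u i - y‖ ^ 2 ≤ c}
  have hbelow : BddBelow S := by
    refine ⟨0, ?_⟩
    rintro c ⟨y, -, hy⟩
    exact (sq_nonneg _).trans (hy (Classical.arbitrary ι))
  have hS : S.Nonempty := by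
    obtain ⟨y, hy⟩ := hne
    obtain ⟨r, hr⟩ := hu.subset_closedBall y
    refine ⟨r ^ 2, y, hy, fun i => ?_⟩
    have h : ‖u i - y‖ ≤ r := by
      simpa [dist_eq_norm] using hr (Set.mem_range_self i)
    gcongr
  set m := sInf S with hm
  have key : ∀ c : ℝ, ∀ y ∈ C, ∀ z ∈ C, (∀ i, ‖u i - y‖ ^ 2 ≤ c) →
      (∀ i, ‖u i - z‖ ^ 2 ≤ c) → ‖y - z‖ ^ 2 ≤ 4 * (c - m) := by
    intro c y hy z hz hyc hzc
    have hmem : c - ‖y - z‖ ^ 2 / 4 ∈ S := by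
      refine ⟨(1 / 2 : ℝ) • y + (1 / 2 : ℝ) • z,
        hconv hy hz (by norm_num) (by norm_num) (by norm_num), fun i => ?_⟩
      have hpar := parallelogram_law_with_norm ℝ (u i - y) (u i - z)
      have hadd : (u i - y) + (u i - z) =
          (2 : ℝ) • (u i - ((1 / 2 : ℝ) • y + (1 / 2 : ℝ) • z)) := by
        module
      have hsub : (u i - y) - (u i - z) = -(y - z) := by abel
      rw [hadd, hsub, norm_neg, norm_smul, Real.norm_ofNat] at hpar
      nlinarith [hyc i, hzc i]
    linarith [csInf_le hbelow hmem]
  have happrox : ∀ n : ℕ, ∃ y ∈ C, ∀ i, ‖u i - y‖ ^ 2 ≤ m + 1 / ((n : ℝ) + 1) := by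
    intro n
    obtain ⟨c, ⟨y, hy, hyc⟩, hc⟩ :=
      exists_lt_of_csInf_lt hS (show sInf S < m + 1 / ((n : ℝ) + 1) by
        linarith [Nat.one_div_pos_of_nat (α := ℝ) (n := n)])
    exact ⟨y, hy, fun i => (hyc i).trans hc.le⟩
  choose y hyC hy using happrox
  have hlim := tendsto_one_div_add_atTop_nhds_zero_nat (𝕜 := ℝ)
  have hcauchy : CauchySeq y := by
    refine cauchySeq_of_le_tendsto_0' (fun n : ℕ => √(4 * (1 / ((n : ℝ) + 1)))) ?_ ?_
    · intro n k hnk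
      rw [dist_eq_norm]
      refine Real.le_sqrt_of_sq_le ?_
      have h := key (m + 1 / ((n : ℝ) + 1)) (y n) (hyC n) (y k) (hyC k) (hy n)
        (fun i => (hy k i).trans (by linarith [Nat.one_div_le_one_div (α := ℝ) hnk]))
      linarith
    · simpa using (hlim.const_mul 4).sqrt
  obtain ⟨z, hz⟩ := cauchySeq_tendsto_of_complete hcauchy
  have hzC : z ∈ C := hclosed.mem_of_tendsto hz (Filter.Eventually.of_forall hyC)
  have hzm : ∀ i, ‖u i - z‖ ^ 2 ≤ m := by
    intro i
    have hbound := hlim.const_add m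
    rw [add_zero] at hbound
    exact le_of_tendsto_of_tendsto' ((hz.const_sub (u i)).norm.pow 2) hbound
      (fun n => hy n i)
  refine ⟨m, z, ⟨hzC, hzm⟩, ?_⟩
  rintro w ⟨hwC, hwm⟩
  have h := key m w hwC z hzC hwm hzm
  rw [sub_self, mul_zero] at h
  exact sub_eq_zero.mp (norm_eq_zero.mp (pow_eq_zero_iff two_ne_zero |>.mp
    (le_antisymm h (sq_nonneg _))))

/-- The points whose `r`-ball is contained in a given set form a closed set. -/
theorem isClosed_setOf_ball_subset {E : Type*} [PseudoMetricSpace E] (Ω : Set E) (r : ℝ) :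
    IsClosed {y | Metric.ball y r ⊆ Ω} := by
  have h : {y | Metric.ball y r ⊆ Ω} = ⋂ p ∈ Ωᶜ, {y | r ≤ dist p y} := by
    ext y
    simp only [Set.mem_ofPred_eq, Set.mem_iInter, Set.mem_compl_iff, Set.subset_def,
      Metric.mem_ball]
    exact forall_congr' fun p => by rw [← not_lt, not_imp_not]
  rw [h]
  exact isClosed_biInter fun p _ => isClosed_le continuous_const (by fun_prop)

/-- The points whose `r`-ball is contained in a given convex set form a convex set. -/
theorem Convex.setOf_ball_subset {E : Type*} [NormedAddCommGroup E] [NormedSpace ℝ E]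
    {Ω : Set E} (hΩ : Convex ℝ Ω) (r : ℝ) : Convex ℝ {y | Metric.ball y r ⊆ Ω} := by
  intro y hy z hz a b ha hb hab p hp
  set d := p - (a • y + b • z) with hd
  have hmem : ∀ q : E, q + d ∈ Metric.ball q r := fun q => by
    simpa [hd, dist_eq_norm] using hp
  have hp' : p = a • (y + d) + b • (z + d) := by
    calc p = (a • y + b • z) + (1 : ℝ) • d := by rw [one_smul, hd]; abel
      _ = a • (y + d) + b • (z + d) := by rw [← hab]; module
  rw [hp']
  exact hΩ (hy (hmem y)) (hz (hmem z)) ha hb hab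

/-- A group acting by affine isometries on a Hilbert space with a bounded orbit fixes a point
in every nonempty invariant closed convex set. -/
theorem exists_fixed_point_of_isClosed_convex_of_bounded_orbit
    {E : Type*} [NormedAddCommGroup E] [InnerProductSpace ℝ E] [CompleteSpace E]
    {G : Type*} [Group G] (σ : G →* (E ≃ᵃⁱ[ℝ] E))
    {C : Set E} (hconv : Convex ℝ C) (hclosed : IsClosed C) (hne : C.Nonempty)
    (hinv : ∀ g : G, ∀ y ∈ C, σ g y ∈ C) (x : E)
    (hbdd : Bornology.IsBounded (Set.range fun g : G => σ g x)) :
    ∃ z ∈ C, ∀ g : G, σ g z = z := by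
  obtain ⟨m, z, ⟨hzC, hzm⟩, huniq⟩ :=
    exists_unique_circumcenter_of_isClosed_convex hbdd hconv hclosed hne
  refine ⟨z, hzC, fun g => huniq _ ⟨hinv g z hzC, fun h => ?_⟩⟩
  have hmul : σ h x = σ g (σ (g⁻¹ * h) x) := by
    rw [← Function.comp_apply (f := σ g), ← AffineIsometryEquiv.coe_mul, ← map_mul,
      mul_inv_cancel_left]
  rw [hmul, ← dist_eq_norm, (σ g).dist_map, dist_eq_norm]
  exact hzm (g⁻¹ * h)

/-- **Bruhat–Tits fixed point for convex sets.** If a group `G` acts on a real Hilbert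
space `E` by affine isometric bijections, `Ω` is a nonempty invariant open or closed
convex subset, and some point of `Ω` has a bounded `G`-orbit, then `Ω` contains a
`G`-fixed point. -/
theorem fixed_point_in_invariant_convex_of_bounded_orbit
    {E : Type*} [NormedAddCommGroup E] [InnerProductSpace ℝ E] [CompleteSpace E]
    {G : Type*} [Group G] (σ : G →* (E ≃ᵃⁱ[ℝ] E))
    (Ω : Set E) (hconv : Convex ℝ Ω) (hoc : IsOpen Ω ∨ IsClosed Ω)
    (hinv : ∀ g : G, (σ g) '' Ω ⊆ Ω)
    (x : E) (hx : x ∈ Ω)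
    (hbdd : Bornology.IsBounded (Set.range fun g : G => σ g x)) :
    ∃ z ∈ Ω, ∀ g : G, σ g z = z := by
  rcases hoc with hopen | hclosed
  · obtain ⟨r, hr, hball⟩ := Metric.isOpen_iff.mp hopen x hx
    obtain ⟨z, hz, hfix⟩ := exists_fixed_point_of_isClosed_convex_of_bounded_orbit σ
      (hconv.setOf_ball_subset r) (isClosed_setOf_ball_subset Ω r) ⟨x, hball⟩
      (fun g y hy => by
        have hball_image : σ g '' Metric.ball y r = Metric.ball (σ g y) r :=
          (σ g).toIsometryEquiv.image_ball y r
        exact hball_image.ge.trans ((Set.image_mono hy).trans (hinv g))) x hbdd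
    exact ⟨z, hz (Metric.mem_ball_self hr), hfix⟩
  · exact exists_fixed_point_of_isClosed_convex_of_bounded_orbit σ hconv hclosed ⟨x, hx⟩
      (fun g y hy => hinv g ⟨y, hy, rfl⟩) x hbdd
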